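/- arXiv:math/0301003 — 4 statements merged into one kernel-verified Lean document; each statement's English description precedes it below -/
import Mathlib

section
/- Let σ and τ be 2-partitions of a finite set S. Then δ(σ,τ) = 1 if and only if there exists a partition of S into three nonempty pairwise disjoint subsets ρ₁, ρ₂, ρ₃ such that one of the partitions σ, τ equals {ρ₁ ∪ ρ₂, ρ₃} and the other equals {ρ₁, ρ₂ ∪ ρ₃}; moreover, in this case the triple (ρ₁, ρ₂, ρ₃) is determined uniquely up to interchanging ρ₁ and ρ₃ (with the corresponding exchange of the roles of σ and τ). -/
open scoped Classical
noncomputable section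

namespace EMO

/-- `σ` is an unordered 2-partition of the set `X`: two distinct nonempty disjoint parts
whose union is `X`. -/
def IsTwoPartitionOn {γ : Type*} (X : Set γ) (σ : Set (Set γ)) : Prop :=
  ∃ A B : Set γ, σ = {A, B} ∧ A ≠ B ∧ A.Nonempty ∧ B.Nonempty ∧ Disjoint A B ∧ A ∪ B = X

/-- unordered 2-partition of the whole set. -/
def IsTwoPartition {γ : Type*} (σ : Set (Set γ)) : Prop :=
  IsTwoPartitionOn Set.univ σ

/-- `δ(σ,τ)`: the number of nonempty pairwise distinct sets among the intersections
`A ∩ B`, `A ∈ σ`, `B ∈ τ`, minus 2. -/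
def delta {γ : Type*} (σ τ : Set (Set γ)) : ℤ :=
  ({C : Set γ | C.Nonempty ∧ ∃ A ∈ σ, ∃ B ∈ τ, C = A ∩ B}.ncard : ℤ) - 2

/-- `a b σ c d` : the elements `a,b` lie in one part of `σ` and `c,d` in the other. -/
def SplitsPair {γ : Type*} (σ : Set (Set γ)) (a b c d : γ) : Prop :=
  ∃ A ∈ σ, ∃ B ∈ σ, A ≠ B ∧ a ∈ A ∧ b ∈ A ∧ c ∈ B ∧ d ∈ B

/-- a painted stable 2-partition w.r.t. the set `W` of white elements: each part
contains a white element and has at least two elements. -/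
def PaintedStablePart {γ : Type*} (W : Set γ) (σ : Set (Set γ)) : Prop :=
  IsTwoPartition σ ∧ ∀ A ∈ σ, (A ∩ W).Nonempty ∧ 2 ≤ A.ncard

/-- an allowed quadruple: pairwise distinct, and each of the pairs
`{i,j}`, `{k,l}`, `{k,j}`, `{i,l}` contains a white element. -/
def Allowed {γ : Type*} (W : Set γ) (i j k l : γ) : Prop :=
  i ≠ j ∧ i ≠ k ∧ i ≠ l ∧ j ≠ k ∧ j ≠ l ∧ k ≠ l ∧
  (i ∈ W ∨ j ∈ W) ∧ (k ∈ W ∨ l ∈ W) ∧ (k ∈ W ∨ j ∈ W) ∧ (i ∈ W ∨ l ∈ W)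

end EMO

namespace EMO

/-- The configuration witnessing `δ(σ,τ) = 1`: a partition of `S` into three nonempty
pairwise disjoint subsets `ρ₁, ρ₂, ρ₃` such that one of `σ, τ` is `{ρ₁ ∪ ρ₂, ρ₃}` and
the other is `{ρ₁, ρ₂ ∪ ρ₃}`. -/
def ChainTriple {S : Type*} (σ τ : Set (Set S)) (ρ₁ ρ₂ ρ₃ : Set S) : Prop :=
  ρ₁.Nonempty ∧ ρ₂.Nonempty ∧ ρ₃.Nonempty ∧
  Disjoint ρ₁ ρ₂ ∧ Disjoint ρ₁ ρ₃ ∧ Disjoint ρ₂ ρ₃ ∧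
  ρ₁ ∪ ρ₂ ∪ ρ₃ = Set.univ ∧
  ((σ = {ρ₁ ∪ ρ₂, ρ₃} ∧ τ = {ρ₁, ρ₂ ∪ ρ₃}) ∨ (τ = {ρ₁ ∪ ρ₂, ρ₃} ∧ σ = {ρ₁, ρ₂ ∪ ρ₃}))

theorem ChainTriple.nonempty_inter_pairs_eq {S : Type*} {ρ₁ ρ₂ ρ₃ : Set S} {σ τ : Set (Set S)}
    (h : ChainTriple σ τ ρ₁ ρ₂ ρ₃) :
    {C : Set S | C.Nonempty ∧ ∃ A ∈ σ, ∃ B ∈ τ, C = A ∩ B} = {ρ₁, ρ₂, ρ₃} := by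
  obtain ⟨h1, h2, h3, d12, d13, d23, -, h⟩ := h
  have e1 : (ρ₁ ∪ ρ₂) ∩ ρ₁ = ρ₁ := by simp
  have e2 : (ρ₁ ∪ ρ₂) ∩ (ρ₂ ∪ ρ₃) = ρ₂ := by
    ext x
    have : x ∈ ρ₁ → x ∉ ρ₃ := fun h => Set.disjoint_left.1 d13 h
    simp only [Set.mem_inter_iff, Set.mem_union]
    tauto
  have e3 : ρ₃ ∩ ρ₁ = ∅ := d13.symm.inter_eq
  have e4 : ρ₃ ∩ (ρ₂ ∪ ρ₃) = ρ₃ := by simp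
  have e1' : ρ₁ ∩ (ρ₁ ∪ ρ₂) = ρ₁ := by simp
  have e2' : (ρ₂ ∪ ρ₃) ∩ (ρ₁ ∪ ρ₂) = ρ₂ := by rw [Set.inter_comm, e2]
  have e3' : ρ₁ ∩ ρ₃ = ∅ := d13.inter_eq
  have e4' : (ρ₂ ∪ ρ₃) ∩ ρ₃ = ρ₃ := by simp
  ext C
  rcases h with ⟨rfl, rfl⟩ | ⟨rfl, rfl⟩ <;>
    simp only [Set.mem_ofPred_eq, Set.mem_insert_iff, Set.mem_singleton_iff, exists_eq_or_imp,
      exists_eq_left, e1, e2, e3, e4, e1', e2', e3', e4'] <;>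
    constructor
  · rintro ⟨hC, (h | h) | h | h⟩ <;> simp_all
  · rintro (rfl | rfl | rfl) <;> simp_all
  · rintro ⟨hC, (h | h) | h | h⟩ <;> simp_all
  · rintro (rfl | rfl | rfl) <;> simp_all

theorem ChainTriple.delta_eq_one {S : Type*} {ρ₁ ρ₂ ρ₃ : Set S} {σ τ : Set (Set S)}
    (h : ChainTriple σ τ ρ₁ ρ₂ ρ₃) : delta σ τ = 1 := by
  rw [delta, h.nonempty_inter_pairs_eq]
  obtain ⟨h1, h2, -, d12, d13, d23, -⟩ := h
  rw [Set.ncard_eq_three.2 ⟨ρ₁, ρ₂, ρ₃, d12.ne h1.ne_empty, d13.ne h1.ne_empty,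
    d23.ne h2.ne_empty, rfl⟩]
  norm_num

theorem ChainTriple.swap {S : Type*} {ρ₁ ρ₂ ρ₃ : Set S} {σ τ : Set (Set S)}
    (h : ChainTriple σ τ ρ₁ ρ₂ ρ₃) : ChainTriple σ τ ρ₃ ρ₂ ρ₁ := by
  obtain ⟨h1, h2, h3, d12, d13, d23, hu, h⟩ := h
  refine ⟨h3, h2, h1, d23.symm, d13.symm, d12.symm, ?_, ?_⟩
  · rw [← hu, Set.union_comm, Set.union_comm ρ₃, Set.union_assoc]
  · rw [Set.union_comm ρ₃, Set.union_comm ρ₂ ρ₁, Set.pair_comm _ ρ₁, Set.pair_comm ρ₃]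
    tauto

/-- A chain triple is determined by the two partitions once their roles are fixed. -/
theorem ChainTriple.eq_of_pair_eq {S : Type*} {ρ₁ ρ₂ ρ₃ ρ₁' ρ₂' ρ₃' : Set S}
    {σ τ σ' τ' : Set (Set S)}
    (h : ChainTriple σ τ ρ₁ ρ₂ ρ₃) (h' : ChainTriple σ' τ' ρ₁' ρ₂' ρ₃')
    (h₃ : ({ρ₁' ∪ ρ₂', ρ₃'} : Set (Set S)) = {ρ₁ ∪ ρ₂, ρ₃})
    (h₁ : ({ρ₁', ρ₂' ∪ ρ₃'} : Set (Set S)) = {ρ₁, ρ₂ ∪ ρ₃}) :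
    ρ₁' = ρ₁ ∧ ρ₂' = ρ₂ ∧ ρ₃' = ρ₃ := by
  obtain ⟨⟨x, hx⟩, ⟨y, hy⟩, ⟨z, hz⟩, d12, d13, d23, hu, -⟩ := h
  obtain ⟨-, -, -, d12', d13', d23', hu', -⟩ := h'
  rw [Set.disjoint_left] at *
  rw [Set.pair_eq_pair_iff] at h₁ h₃
  rcases h₃ with ⟨h₃, rfl⟩ | ⟨h₃, rfl⟩ <;> rcases h₁ with ⟨rfl, h₁⟩ | ⟨rfl, h₁⟩
  · refine ⟨rfl, ?_, rfl⟩
    ext w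
    have := Set.ext_iff.1 h₃ w
    have := @d12 w
    have := @d12' w
    simp only [Set.mem_union] at *
    tauto
  · exact (d13' (Or.inr hz) hz).elim
  · exact (d13' hx (Or.inl hx)).elim
  · exact (d13' (Or.inl hy) (Or.inr hy)).elim

theorem ChainTriple.eq_or_eq_swap {S : Type*} {ρ₁ ρ₂ ρ₃ ρ₁' ρ₂' ρ₃' : Set S}
    {σ τ : Set (Set S)}
    (h : ChainTriple σ τ ρ₁ ρ₂ ρ₃) (h' : ChainTriple σ τ ρ₁' ρ₂' ρ₃') :
    (ρ₁' = ρ₁ ∧ ρ₂' = ρ₂ ∧ ρ₃' = ρ₃) ∨ (ρ₁' = ρ₃ ∧ ρ₂' = ρ₂ ∧ ρ₃' = ρ₁) := by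
  have key := h.eq_of_pair_eq h'
  have key' := h.swap.eq_of_pair_eq h'
  rw [Set.union_comm ρ₃, Set.union_comm ρ₂ ρ₁, Set.pair_comm _ ρ₁, Set.pair_comm ρ₃] at key'
  obtain ⟨-, -, -, -, -, -, -, h⟩ := h
  obtain ⟨-, -, -, -, -, -, -, h'⟩ := h'
  rcases h with ⟨h, k⟩ | ⟨h, k⟩ <;> rcases h' with ⟨h', k'⟩ | ⟨h', k'⟩
  · exact .inl (key (h'.symm.trans h) (k'.symm.trans k))
  · exact .inr (key' (h'.symm.trans k) (k'.symm.trans h))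
  · exact .inr (key' (h'.symm.trans k) (k'.symm.trans h))
  · exact .inl (key (h'.symm.trans h) (k'.symm.trans k))

theorem exists_chainTriple_of_inter_eq_empty {S : Type*} {A B C D : Set S}
    (hA : A.Nonempty) (hD : D.Nonempty)
    (hAB : Disjoint A B) (hABu : A ∪ B = Set.univ) (hCD : Disjoint C D) (hCDu : C ∪ D = Set.univ)
    (hδ : delta {A, B} {C, D} = 1) (hAD : A ∩ D = ∅) :
    ∃ ρ₁ ρ₂ ρ₃ : Set S, ChainTriple {A, B} {C, D} ρ₁ ρ₂ ρ₃ := by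
  have hBC : (B ∩ C).Nonempty := by
    by_contra hBC
    rw [Set.not_nonempty_iff_eq_empty] at hBC
    have hsub : {X : Set S | X.Nonempty ∧ ∃ Y ∈ ({A, B} : Set (Set S)),
        ∃ Z ∈ ({C, D} : Set (Set S)), X = Y ∩ Z} ⊆ {A ∩ C, B ∩ D} := by
      rintro X ⟨hX, Y, rfl | rfl, Z, rfl | rfl, rfl⟩ <;> simp_all
    have h₁ := Set.ncard_le_ncard hsub
    have h₂ := Set.ncard_insert_le (A ∩ C) {B ∩ D}
    rw [Set.ncard_singleton] at h₂
    rw [delta] at hδ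
    omega
  have hB : B = (B ∩ C) ∪ D := by
    ext x
    have h₁ := Set.ext_iff.1 hABu x
    have h₂ := Set.ext_iff.1 hCDu x
    have h₃ := Set.ext_iff.1 hAD x
    simp only [Set.mem_union, Set.mem_inter_iff, Set.mem_univ, Set.mem_empty_iff_false] at *
    tauto
  have hC : C = A ∪ (B ∩ C) := by
    ext x
    have h₁ := Set.ext_iff.1 hABu x
    have h₂ := Set.ext_iff.1 hCDu x
    have h₃ := Set.ext_iff.1 hAD x
    simp only [Set.mem_union, Set.mem_inter_iff, Set.mem_univ, Set.mem_empty_iff_false] at *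
    tauto
  refine ⟨A, B ∩ C, D, hA, hBC, hD, hAB.mono_right Set.inter_subset_left,
    Set.disjoint_iff_inter_eq_empty.2 hAD, hCD.mono_left Set.inter_subset_right, ?_, .inr ?_⟩
  · rw [← hC, hCDu]
  · rw [← hB, ← hC]
    exact ⟨rfl, rfl⟩

theorem delta_eq_two_of_nonempty {S : Type*} {A B C D : Set S}
    (hAB : Disjoint A B) (hCD : Disjoint C D)
    (hAC : (A ∩ C).Nonempty) (hAD : (A ∩ D).Nonempty)
    (hBC : (B ∩ C).Nonempty) (hBD : (B ∩ D).Nonempty) :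
    delta {A, B} {C, D} = 2 := by
  have heq : {X : Set S | X.Nonempty ∧ ∃ Y ∈ ({A, B} : Set (Set S)),
      ∃ Z ∈ ({C, D} : Set (Set S)), X = Y ∩ Z} = {A ∩ C, A ∩ D, B ∩ C, B ∩ D} := by
    ext X
    constructor
    · rintro ⟨-, Y, rfl | rfl, Z, rfl | rfl, rfl⟩ <;> simp
    · rintro (rfl | rfl | rfl | rfl) <;> simp_all
  have row (X Y : Set S) (h : (A ∩ X).Nonempty) : A ∩ X ≠ B ∩ Y :=
    (hAB.mono Set.inter_subset_left Set.inter_subset_left).ne h.ne_empty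
  have col (X : Set S) (h : (X ∩ C).Nonempty) : X ∩ C ≠ X ∩ D :=
    (hCD.mono Set.inter_subset_right Set.inter_subset_right).ne h.ne_empty
  rw [delta, heq, Set.ncard_insert_of_notMem, Set.ncard_insert_of_notMem,
    Set.ncard_pair (col B hBC)]
  · norm_num
  · simp [row D C hAD, row D D hAD]
  · simp [col A hAC, row C C hAC, row C D hAC]

/-- For 2-partitions `σ, τ` of a finite set `S`: `δ(σ,τ) = 1` iff there
is a partition of `S` into three nonempty pairwise disjoint subsets `ρ₁, ρ₂, ρ₃` with
one of `σ, τ` equal to `{ρ₁ ∪ ρ₂, ρ₃}` and the other to `{ρ₁, ρ₂ ∪ ρ₃}`; moreover the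
triple `(ρ₁, ρ₂, ρ₃)` is unique up to interchanging `ρ₁` and `ρ₃`. -/
theorem delta_eq_one_iff_chainTriple {S : Type*} [Finite S]
    (σ τ : Set (Set S)) (hσ : IsTwoPartition σ) (hτ : IsTwoPartition τ) :
    (delta σ τ = 1 ↔ ∃ ρ₁ ρ₂ ρ₃ : Set S, ChainTriple σ τ ρ₁ ρ₂ ρ₃) ∧
    (∀ ρ₁ ρ₂ ρ₃ ρ₁' ρ₂' ρ₃' : Set S, ChainTriple σ τ ρ₁ ρ₂ ρ₃ →
      ChainTriple σ τ ρ₁' ρ₂' ρ₃' →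
      (ρ₁' = ρ₁ ∧ ρ₂' = ρ₂ ∧ ρ₃' = ρ₃) ∨ (ρ₁' = ρ₃ ∧ ρ₂' = ρ₂ ∧ ρ₃' = ρ₁)) := by
  refine ⟨⟨fun hδ => ?_, fun ⟨_, _, _, h⟩ => h.delta_eq_one⟩,
    fun _ _ _ _ _ _ h h' => h.eq_or_eq_swap h'⟩
  obtain ⟨A, B, rfl, -, hA, hB, hAB, hABu⟩ := hσ
  obtain ⟨C, D, rfl, -, hC, hD, hCD, hCDu⟩ := hτ
  have hBAu : B ∪ A = Set.univ := by rw [Set.union_comm, hABu]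
  have hDCu : D ∪ C = Set.univ := by rw [Set.union_comm, hCDu]
  rcases (A ∩ D).eq_empty_or_nonempty with hAD | hAD
  · exact exists_chainTriple_of_inter_eq_empty hA hD hAB hABu hCD hCDu hδ hAD
  rcases (A ∩ C).eq_empty_or_nonempty with hAC | hAC
  · rw [Set.pair_comm C D] at hδ ⊢
    exact exists_chainTriple_of_inter_eq_empty hA hC hAB hABu hCD.symm hDCu hδ hAC
  rcases (B ∩ D).eq_empty_or_nonempty with hBD | hBD
  · rw [Set.pair_comm A B] at hδ ⊢
    exact exists_chainTriple_of_inter_eq_empty hB hD hAB.symm hBAu hCD hCDu hδ hBD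
  rcases (B ∩ C).eq_empty_or_nonempty with hBC | hBC
  · rw [Set.pair_comm A B, Set.pair_comm C D] at hδ ⊢
    exact exists_chainTriple_of_inter_eq_empty hB hC hAB.symm hBAu hCD.symm hDCu hδ hBC
  rw [delta_eq_two_of_nonempty hAB hCD hAC hAD hBC hBD] at hδ
  norm_num at hδ

end EMO
end
end

section
/- Let S be a painted finite set and let σ, τ be painted stable 2-partitions of S with δ(σ,τ) = 2. Then there exist pairwise distinct i, j, k, l ∈ S with j, i in one part of σ and k, l in the other, and j, k in one part of τ and i, l in the other, such that moreover each of the four pairs {i,j}, {k,l}, {k,j}, {i,l} contains a white element; equivalently, the 2-partitions induced by σ and by τ on the painted set {i,j,k,l} are both painted stable. -/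
open scoped Classical
noncomputable section

namespace EMO

/-- If `δ({A, A'}, {B, B'}) = 2`, then `A ∩ B` is nonempty; the other three intersections
follow by swapping the elements of the pairs. -/
theorem inter_nonempty_of_delta_eq_two {γ : Type*} {A A' B B' : Set γ}
    (h : delta {A, A'} {B, B'} = 2) : (A ∩ B).Nonempty := by
  by_contra hAB
  have hsub : {C : Set γ | C.Nonempty ∧ ∃ X ∈ ({A, A'} : Set (Set γ)),
      ∃ Y ∈ ({B, B'} : Set (Set γ)), C = X ∩ Y} ⊆ {A ∩ B', A' ∩ B, A' ∩ B'} := by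
    rintro C ⟨hC, X, rfl | rfl, Y, rfl | rfl, rfl⟩
    · exact absurd hC hAB
    · exact Or.inl rfl
    · exact Or.inr (Or.inl rfl)
    · exact Or.inr (Or.inr rfl)
  have hle := Set.ncard_le_ncard hsub (Set.toFinite _)
  have h₁ := Set.ncard_insert_le (A ∩ B') {A' ∩ B, A' ∩ B'}
  have h₂ := Set.ncard_insert_le (A' ∩ B) {A' ∩ B'}
  rw [Set.ncard_singleton] at h₂
  unfold delta at h
  omega

/-- A nonempty set has an element which is white as soon as the set has a white element. -/
theorem exists_mem_white_of_nonempty {γ : Type*} (W : Set γ) {C : Set γ} (hC : C.Nonempty) :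
    ∃ x ∈ C, ∀ y ∈ C, y ∈ W → x ∈ W := by
  by_cases h : (C ∩ W).Nonempty
  · obtain ⟨x, hx, hxW⟩ := h
    exact ⟨x, hx, fun _ _ _ => hxW⟩
  · obtain ⟨x, hx⟩ := hC
    exact ⟨x, hx, fun y hy hyW => absurd ⟨y, hy, hyW⟩ h⟩

/-- If `σ, τ` are painted stable 2-partitions of a painted finite set
`S` (with white elements `W`) and `δ(σ,τ) = 2`, then a witnessing quadruple
`i, j, k, l` can be chosen to be *allowed*: each of the pairs `{i,j}`, `{k,l}`,
`{k,j}`, `{i,l}` contains a white element (equivalently, the 2-partitions induced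
by `σ` and `τ` on `{i,j,k,l}` are painted stable). -/
theorem delta_eq_two_allowed_quadruple {S : Type*} [Finite S] (W : Set S)
    (σ τ : Set (Set S)) (hσ : PaintedStablePart W σ) (hτ : PaintedStablePart W τ)
    (h2 : delta σ τ = 2) :
    ∃ i j k l : S, Allowed W i j k l ∧ SplitsPair σ j i k l ∧ SplitsPair τ j k i l := by
  obtain ⟨⟨A, A', rfl, hA, -, -, hAd, hAu⟩, hσW⟩ := hσ
  obtain ⟨⟨B, B', rfl, hB, -, -, hBd, hBu⟩, hτW⟩ := hτ
  obtain ⟨j, ⟨hjA, hjB⟩, hj⟩ :=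
    exists_mem_white_of_nonempty W (inter_nonempty_of_delta_eq_two h2)
  obtain ⟨i, ⟨hiA, hiB⟩, hi⟩ := exists_mem_white_of_nonempty W
    (inter_nonempty_of_delta_eq_two (Set.pair_comm B B' ▸ h2))
  obtain ⟨k, ⟨hkA, hkB⟩, hk⟩ := exists_mem_white_of_nonempty W
    (inter_nonempty_of_delta_eq_two (Set.pair_comm A A' ▸ h2))
  obtain ⟨l, ⟨hlA, hlB⟩, hl⟩ := exists_mem_white_of_nonempty W
    (inter_nonempty_of_delta_eq_two (Set.pair_comm A A' ▸ Set.pair_comm B B' ▸ h2))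
  have memA (x : S) : x ∈ A ∨ x ∈ A' := by simpa [← hAu] using Set.mem_univ x
  have memB (x : S) : x ∈ B ∨ x ∈ B' := by simpa [← hBu] using Set.mem_univ x
  obtain ⟨a, haA, haW⟩ := (hσW A (by simp)).1
  obtain ⟨a', haA', haW'⟩ := (hσW A' (by simp)).1
  obtain ⟨b, hbB, hbW⟩ := (hτW B (by simp)).1
  obtain ⟨b', hbB', hbW'⟩ := (hτW B' (by simp)).1
  refine ⟨i, j, k, l, ⟨?_, ?_, ?_, ?_, ?_, ?_, ?_, ?_, ?_, ?_⟩,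
    ⟨A, by simp, A', by simp, hA, hjA, hiA, hkA, hlA⟩,
    ⟨B, by simp, B', by simp, hB, hjB, hkB, hiB, hlB⟩⟩
  · exact (hBd.ne_of_mem hjB hiB).symm
  · exact hAd.ne_of_mem hiA hkA
  · exact hAd.ne_of_mem hiA hlA
  · exact hAd.ne_of_mem hjA hkA
  · exact hAd.ne_of_mem hjA hlA
  · exact hBd.ne_of_mem hkB hlB
  · exact (memB a).elim (fun h => .inr (hj a ⟨haA, h⟩ haW)) fun h => .inl (hi a ⟨haA, h⟩ haW)
  · exact (memB a').elim (fun h => .inl (hk a' ⟨haA', h⟩ haW'))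
      fun h => .inr (hl a' ⟨haA', h⟩ haW')
  · exact (memA b).elim (fun h => .inr (hj b ⟨h, hbB⟩ hbW)) fun h => .inl (hk b ⟨h, hbB⟩ hbW)
  · exact (memA b').elim (fun h => .inl (hi b' ⟨h, hbB'⟩ hbW'))
      fun h => .inr (hl b' ⟨h, hbB'⟩ hbW')

end EMO
end
end

section
/- For any painted stable S-tree τ, the 2-partitions σ_e, e ∈ E_τ, are pairwise distinct and the set {σ_e : e ∈ E_τ} is a good family of painted stable 2-partitions of S. -/
open scoped Classical
noncomputable section

namespace EMO

/-- a good family of painted stable 2-partitions: pairwise `δ = 1`. -/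
def GoodFamily {γ : Type*} (W : Set γ) (E : Set (Set (Set γ))) : Prop :=
  (∀ σ ∈ E, PaintedStablePart W σ) ∧ ∀ σ ∈ E, ∀ σ' ∈ E, σ ≠ σ' → delta σ σ' = 1

/-- `ε(σ; i,j,k,l)`. -/
def eps {γ : Type*} (σ : Set (Set γ)) (i j k l : γ) : ℤ :=
  if SplitsPair σ i j k l then 1 else if SplitsPair σ k j i l then -1 else 0

/-- A tree whose tails are bijectively labeled by `γ`: a finite graph
(vertices, flags, incidence map, involution) whose geometric realization is
connected and simply connected (edge count), together with a labeling of the tails. -/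
structure LTree (γ : Type) where
  V : Type
  Fl : Type
  [finV : Finite V]
  [finF : Finite Fl]
  bd : Fl → V
  inv : Fl → Fl
  inv_inv : ∀ f, inv (inv f) = f
  label : γ → Fl
  label_fixed : ∀ s, inv (label s) = label s
  label_inj : Function.Injective label
  label_surj : ∀ f, inv f = f → ∃ s, label s = f
  conn : ∀ v w : V, Relation.ReflTransGen (fun a b => ∃ f, bd f = a ∧ bd (inv f) = b) v w
  tree_count : Nat.card {f : Fl // inv f ≠ f} + 2 = 2 * Nat.card V

attribute [instance] LTree.finV LTree.finF

namespace LTree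

variable {γ : Type} (τ : LTree γ)

/-- flags incident to a vertex. -/
def flagsAt (v : τ.V) : Set τ.Fl := {f | τ.bd f = v}

/-- adjacency avoiding the edge `{f, inv f}`. -/
def sideAdj (f : τ.Fl) (a b : τ.V) : Prop :=
  ∃ g, g ≠ f ∧ g ≠ τ.inv f ∧ τ.bd g = a ∧ τ.bd (τ.inv g) = b

/-- labels lying on the `f`-side of the edge `{f, inv f}`. -/
def flagSide (f : τ.Fl) : Set γ :=
  {s | Relation.ReflTransGen (τ.sideAdj f) (τ.bd (τ.label s)) (τ.bd f)}

/-- the 2-partition `σ_e` of the labels determined by the edge `{f, inv f}`. -/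
def flagPartition (f : τ.Fl) : Set (Set γ) := {τ.flagSide f, τ.flagSide (τ.inv f)}

/-- the family of 2-partitions of labels determined by the edges of `τ`. -/
def edgeFamily : Set (Set (Set γ)) := {σ | ∃ f, τ.inv f ≠ f ∧ τ.flagPartition f = σ}

/-- painted stability: every vertex carries at least three flags, and every
end vertex carries a white tail. -/
def PaintedStable (W : Set γ) : Prop :=
  (∀ v : τ.V, 3 ≤ Nat.card {f : τ.Fl // τ.bd f = v}) ∧
  (∀ v : τ.V, Nat.card {f : τ.Fl // τ.bd f = v ∧ τ.inv f ≠ f} ≤ 1 →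
    ∃ s ∈ W, τ.bd (τ.label s) = v)

/-- adjacency avoiding the vertex `v`. -/
def avoidAdj (v : τ.V) (a b : τ.V) : Prop :=
  a ≠ v ∧ b ≠ v ∧ ∃ g, τ.bd g = a ∧ τ.bd (τ.inv g) = b

/-- the labels carried by the branch of `τ` at `v` starting with the flag `φ`. -/
def branchLabels (v : τ.V) (φ : τ.Fl) : Set γ :=
  {s | τ.label s = φ ∨
    (τ.inv φ ≠ φ ∧ Relation.ReflTransGen (τ.avoidAdj v) (τ.bd (τ.inv φ)) (τ.bd (τ.label s)))}

/-- the 2-partition of labels induced by a 2-partition `α` of the flags at `v`. -/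
def inducedSPart (v : τ.V) (α : Set (Set τ.Fl)) : Set (Set γ) :=
  (fun A => ⋃ φ ∈ A, τ.branchLabels v φ) '' α

/-- painted stable 2-partitions of the set of flags at `v`. -/
def VertexParts (W : Set γ) (v : τ.V) : Set (Set (Set τ.Fl)) :=
  {α | IsTwoPartitionOn (τ.flagsAt v) α ∧ PaintedStablePart W (τ.inducedSPart v α)}

/-- an allowed quadruple of (pairwise distinct) flags at the vertex `v`: there are
labels on the corresponding branches forming an allowed quadruple. -/
def AllowedFlags (W : Set γ) (v : τ.V) (I J K L : τ.Fl) : Prop :=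
  I ∈ τ.flagsAt v ∧ J ∈ τ.flagsAt v ∧ K ∈ τ.flagsAt v ∧ L ∈ τ.flagsAt v ∧
  I ≠ J ∧ I ≠ K ∧ I ≠ L ∧ J ≠ K ∧ J ≠ L ∧ K ≠ L ∧
  ∃ i ∈ τ.branchLabels v I, ∃ j ∈ τ.branchLabels v J,
    ∃ a ∈ τ.branchLabels v K, ∃ b ∈ τ.branchLabels v L, Allowed W i j a b

end LTree

/-- an `S`-isomorphism of labeled trees (flags mapped in the reverse direction). -/
structure SIso {γ : Type} (τ τ' : LTree γ) where
  vmap : τ.V ≃ τ'.V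
  fmap : τ'.Fl ≃ τ.Fl
  bd_comp : ∀ f : τ'.Fl, τ'.bd f = vmap (τ.bd (fmap f))
  inv_comp : ∀ f : τ'.Fl, fmap (τ'.inv f) = τ.inv (fmap f)
  label_comp : ∀ s : γ, fmap (τ'.label s) = τ.label s

/-- a morphism `τ' → τ` of labeled trees contracting the edge `{e₁, inv e₁}` of `τ'`. -/
structure Contraction {γ : Type} (τ' τ : LTree γ) (e₁ : τ'.Fl) where
  cF : τ.Fl → τ'.Fl
  cV : τ'.V → τ.V
  cF_inj : Function.Injective cF
  cF_range : Set.range cF = {f : τ'.Fl | f ≠ e₁ ∧ f ≠ τ'.inv e₁}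
  cF_inv : ∀ f, cF (τ.inv f) = τ'.inv (cF f)
  cF_label : ∀ s : γ, cF (τ.label s) = τ'.label s
  cV_surj : Function.Surjective cV
  cV_bd : ∀ f : τ.Fl, cV (τ'.bd (cF f)) = τ.bd f
  cV_glue : cV (τ'.bd e₁) = cV (τ'.bd (τ'.inv e₁))
  cV_almost_inj : ∀ v w : τ'.V, cV v = cV w →
    v = w ∨ (({v, w} : Set τ'.V) = {τ'.bd e₁, τ'.bd (τ'.inv e₁)})

/-- the polynomial ring `R_S = k[l_σ]` on variables indexed by painted stable
2-partitions. -/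
abbrev PSP (γ : Type) (W : Set γ) := {σ : Set (Set γ) // PaintedStablePart W σ}

abbrev Rring (γ : Type) (W : Set γ) (k : Type) [CommRing k] := MvPolynomial (PSP γ W) k

/-- the variable `l_σ` (or `0` if `σ` is not painted stable). -/
def lvar (γ : Type) (W : Set γ) (k : Type) [CommRing k] (σ : Set (Set γ)) : Rring γ W k :=
  if h : PaintedStablePart W σ then MvPolynomial.X ⟨σ, h⟩ else 0

/-- the element `R_{ijkl} = Σ_σ ε(σ; i,j,k,l) l_σ`. -/
def Rquad (γ : Type) (W : Set γ) (k : Type) [CommRing k] (i j a b : γ) : Rring γ W k :=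
  ∑ᶠ σ : PSP γ W, eps σ.1 i j a b • MvPolynomial.X σ

/-- the ideal `I_S` generated by the `R_{ijkl}` (over allowed quadruples) and the
products `l_σ l_σ'` for crossing pairs `σ, σ'`. -/
def idealI (γ : Type) (W : Set γ) (k : Type) [CommRing k] : Ideal (Rring γ W k) :=
  Ideal.span
    ({p | ∃ i j a b : γ, Allowed W i j a b ∧ p = Rquad γ W k i j a b} ∪
     {p | ∃ σ σ' : PSP γ W, (∃ i j a b : γ, Allowed W i j a b ∧
        SplitsPair σ.1 i j a b ∧ SplitsPair σ'.1 a j i b) ∧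
        p = MvPolynomial.X σ * MvPolynomial.X σ'})

/-- the good monomial `∏_{σ ∈ E} l_σ` of a family `E` of 2-partitions. -/
def mFam (γ : Type) (W : Set γ) (k : Type) [CommRing k] (E : Set (Set (Set γ))) :
    Rring γ W k :=
  ∏ᶠ σ ∈ E, lvar γ W k σ

/-- the combinatorial cohomology ring `H*_S = R_S/I_S`. -/
abbrev HS (γ : Type) (W : Set γ) (k : Type) [CommRing k] := Rring γ W k ⧸ idealI γ W k

/-- good families of painted stable 2-partitions (= iso classes of painted stable trees). -/
abbrev GoodFam (γ : Type) (W : Set γ) := {E : Set (Set (Set γ)) // GoodFamily W E}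

/-- the free `k`-module `M_S` on the iso classes `μ(τ)` of painted stable `S`-trees,
encoded by their families of edge 2-partitions. -/
abbrev MS (γ : Type) (W : Set γ) (k : Type) [CommRing k] := GoodFam γ W →₀ k

/-- the basis element `μ(τ)` of `M_S` attached to the edge family `E` of `τ`. -/
def muE (γ : Type) (W : Set γ) (k : Type) [CommRing k] (E : Set (Set (Set γ))) : MS γ W k :=
  if h : GoodFamily W E then Finsupp.single ⟨E, h⟩ 1 else 0

/-- the standard relation `r(τ, v; I,J,K,L) = Σ_α ε(α; I,J,K,L) μ(τ(α))`. -/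
def stdRelH (γ : Type) (W : Set γ) (k : Type) [CommRing k]
    (τ : LTree γ) (v : τ.V) (I J K L : τ.Fl) : MS γ W k :=
  ∑ᶠ α ∈ τ.VertexParts W v, eps α I J K L • muE γ W k (τ.edgeFamily ∪ {τ.inducedSPart v α})

/-- the span `J_S` of the standard relations. -/
def JS (γ : Type) (W : Set γ) (k : Type) [CommRing k] : Submodule k (MS γ W k) :=
  Submodule.span k {x | ∃ τ : LTree γ, τ.PaintedStable W ∧ ∃ (v : τ.V) (I J K L : τ.Fl),
    τ.AllowedFlags W v I J K L ∧ x = stdRelH γ W k τ v I J K L}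

/-- the combinatorial homology `H_{*S} = M_S/J_S`. -/
abbrev HsLow (γ : Type) (W : Set γ) (k : Type) [CommRing k] := MS γ W k ⧸ JS γ W k

end EMO

namespace EMO

lemma delta_pair_compl {γ : Type*} {A B : Set γ} (hA : Aᶜ.Nonempty) (hB : Bᶜ.Nonempty)
    (hAB : (A ∩ B).Nonempty) (hd : Aᶜ ⊆ B) : delta {A, Aᶜ} {B, Bᶜ} = 1 := by
  obtain ⟨x, hx⟩ := hA
  obtain ⟨y, hy⟩ := hB
  obtain ⟨z, hz⟩ := hAB
  have hempty : Aᶜ ∩ Bᶜ = ∅ := by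
    ext w
    simp only [Set.mem_inter_iff, Set.mem_compl_iff, Set.mem_empty_iff_false, iff_false, not_and,
      not_not]
    exact fun hw => hd hw
  have h1 : A ∩ Bᶜ = Bᶜ :=
    Set.inter_eq_right.2 fun w hw => by_contra fun h => hw (hd h)
  have h2 : Aᶜ ∩ B = Aᶜ := Set.inter_eq_left.2 hd
  have hset : {C : Set γ | C.Nonempty ∧ ∃ P ∈ ({A, Aᶜ} : Set (Set γ)),
      ∃ Q ∈ ({B, Bᶜ} : Set (Set γ)), C = P ∩ Q} = {A ∩ B, Bᶜ, Aᶜ} := by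
    ext C
    constructor
    · rintro ⟨hC, P, rfl | rfl, Q, rfl | rfl, rfl⟩
      · simp
      · simp [h1]
      · simp [h2]
      · exact absurd hempty hC.ne_empty
    · rintro (rfl | rfl | rfl)
      · exact ⟨⟨z, hz⟩, A, by simp, B, by simp, rfl⟩
      · exact ⟨⟨y, hy⟩, A, by simp, Bᶜ, by simp, h1.symm⟩
      · exact ⟨⟨x, hx⟩, Aᶜ, by simp, B, by simp, h2.symm⟩
  have hn1 : A ∩ B ≠ Bᶜ := fun h => (h ▸ hz : z ∈ Bᶜ) hz.2
  have hn2 : A ∩ B ≠ Aᶜ := fun h => (h ▸ hz : z ∈ Aᶜ) hz.1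
  have hn3 : Bᶜ ≠ Aᶜ := fun h => (h ▸ hx : x ∈ Bᶜ) (hd hx)
  have hcard : ({A ∩ B, Bᶜ, Aᶜ} : Set (Set γ)).ncard = 3 :=
    Set.ncard_eq_three.2 ⟨_, _, _, hn1, hn2, hn3, rfl⟩
  rw [delta, hset, hcard]
  norm_num

/-- A two-element partition has `δ ≤ 0` with itself. -/
lemma delta_pair_compl_self_le {γ : Type*} (A : Set γ) : delta {A, Aᶜ} {A, Aᶜ} ≤ 0 := by
  have hsub : {C : Set γ | C.Nonempty ∧ ∃ P ∈ ({A, Aᶜ} : Set (Set γ)),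
      ∃ Q ∈ ({A, Aᶜ} : Set (Set γ)), C = P ∩ Q} ⊆ {A, Aᶜ} := by
    rintro C ⟨hC, P, rfl | rfl, Q, rfl | rfl, rfl⟩ <;> simp at hC ⊢
  have h := (Set.ncard_le_ncard hsub (Set.toFinite _)).trans (Set.ncard_insert_le A {Aᶜ})
  rw [Set.ncard_singleton] at h
  rw [delta]
  omega

namespace LTree

variable {γ : Type} (τ : LTree γ)

/-- The vertices on the `f`-side of the edge `{f, inv f}`. -/
def vertexSide (f : τ.Fl) : Set τ.V := {v | Relation.ReflTransGen (τ.sideAdj f) v (τ.bd f)}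

variable {τ}

lemma mem_flagSide {f : τ.Fl} {s : γ} : s ∈ τ.flagSide f ↔ τ.bd (τ.label s) ∈ τ.vertexSide f :=
  Iff.rfl

lemma inv_inv_ne {f : τ.Fl} (hf : τ.inv f ≠ f) : τ.inv (τ.inv f) ≠ τ.inv f := by
  rw [τ.inv_inv]
  exact hf.symm

lemma sideAdj_symm {f : τ.Fl} {a b : τ.V} (h : τ.sideAdj f a b) : τ.sideAdj f b a := by
  obtain ⟨g, h1, h2, rfl, rfl⟩ := h
  refine ⟨τ.inv g, ?_, ?_, rfl, by rw [τ.inv_inv]⟩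
  · rintro rfl
    exact h2 (τ.inv_inv g).symm
  · intro h
    apply h1
    rw [← τ.inv_inv g, h, τ.inv_inv]

lemma sideAdj_inv (f : τ.Fl) : τ.sideAdj (τ.inv f) = τ.sideAdj f := by
  ext a b
  simp only [sideAdj, τ.inv_inv]
  exact ⟨fun ⟨g, h1, h2, h⟩ => ⟨g, h2, h1, h⟩, fun ⟨g, h1, h2, h⟩ => ⟨g, h2, h1, h⟩⟩

lemma reflTransGen_sideAdj_symm {f : τ.Fl} {a b : τ.V}
    (h : Relation.ReflTransGen (τ.sideAdj f) a b) : Relation.ReflTransGen (τ.sideAdj f) b a := by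
  induction h with
  | refl => exact .refl
  | tail _ h ih => exact .head (sideAdj_symm h) ih

lemma bd_mem_vertexSide (f : τ.Fl) : τ.bd f ∈ τ.vertexSide f := Relation.ReflTransGen.refl

/-- The two ends of an edge are separated by its removal. -/
lemma bd_inv_notMem_vertexSide {f : τ.Fl} (hf : τ.inv f ≠ f) :
    τ.bd (τ.inv f) ∉ τ.vertexSide f := by
  intro hmem
  have hmem : Relation.ReflTransGen (τ.sideAdj f) (τ.bd (τ.inv f)) (τ.bd f) := hmem
  have hall : ∀ v w : τ.V, Relation.ReflTransGen (τ.sideAdj f) v w := by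
    intro v w
    induction τ.conn v w with
    | refl => exact .refl
    | tail _ h ih =>
      obtain ⟨k, rfl, rfl⟩ := h
      refine ih.trans ?_
      by_cases h1 : k = f
      · subst h1
        exact reflTransGen_sideAdj_symm hmem
      · by_cases h2 : k = τ.inv f
        · subst h2
          rw [τ.inv_inv]
          exact hmem
        · exact .single ⟨k, h1, h2, rfl, rfl⟩
  let G : SimpleGraph τ.V :=
    { Adj := fun a b => a ≠ b ∧ τ.sideAdj f a b
      symm := ⟨fun a b h => ⟨h.1.symm, sideAdj_symm h.2⟩⟩
      loopless := ⟨fun a h => h.1 rfl⟩ }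
  have hconn : G.Connected := by
    have : Nonempty τ.V := ⟨τ.bd f⟩
    refine ⟨fun v w => ?_⟩
    induction hall v w with
    | refl => exact .refl _
    | @tail b c _ h ih =>
      by_cases hbc : b = c
      · exact hbc ▸ ih
      · exact ih.trans (SimpleGraph.Adj.reachable (G := G) ⟨hbc, h⟩)
  have hle := hconn.card_vert_le_card_edgeSet_add_one
  have := Fintype.ofFinite τ.V
  let T : Set τ.Fl := {k | τ.inv k ≠ k ∧ k ≠ f ∧ k ≠ τ.inv f}
  have hdart : Nat.card G.Dart ≤ Nat.card T := by
    have hex : ∀ d : G.Dart, ∃ k : T, τ.bd k = d.fst ∧ τ.bd (τ.inv k) = d.snd := by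
      intro d
      obtain ⟨hne, k, h1, h2, h3, h4⟩ := d.adj
      refine ⟨⟨k, fun h => hne ?_, h1, h2⟩, h3, h4⟩
      rw [← h3, ← h4, h]
    choose φ hφ using hex
    refine Nat.card_le_card_of_injective φ fun d e hde => ?_
    apply SimpleGraph.Dart.ext
    exact Prod.ext ((hφ d).1.symm.trans (hde ▸ (hφ e).1)) ((hφ d).2.symm.trans (hde ▸ (hφ e).2))
  have hE : Nat.card G.Dart = 2 * Nat.card G.edgeSet := by
    rw [Nat.card_eq_fintype_card, SimpleGraph.dart_card_eq_twice_card_edges,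
      Nat.card_eq_fintype_card, SimpleGraph.edgeFinset_card]
  have hT : T.ncard + 2 = Nat.card {k : τ.Fl // τ.inv k ≠ k} := by
    have hset : {k : τ.Fl | τ.inv k ≠ k} = insert f (insert (τ.inv f) T) := by
      ext k
      simp only [T, Set.mem_ofPred_eq, Set.mem_insert_iff]
      constructor
      · tauto
      · rintro (rfl | rfl | h)
        · exact hf
        · exact inv_inv_ne hf
        · exact h.1
    change _ = {k : τ.Fl | τ.inv k ≠ k}.ncard
    rw [hset, Set.ncard_insert_of_notMem, Set.ncard_insert_of_notMem]
    · simp [T]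
    · simp [T, hf.symm]
  have hcount := τ.tree_count
  have hTc : Nat.card T = T.ncard := rfl
  omega

lemma mem_vertexSide_or (f : τ.Fl) (v : τ.V) :
    v ∈ τ.vertexSide f ∨ v ∈ τ.vertexSide (τ.inv f) := by
  have key : ∀ w u : τ.V, τ.sideAdj f w u ∨ w = u ∨ w = τ.bd f ∨ w = τ.bd (τ.inv f) →
      (u ∈ τ.vertexSide f ∨ u ∈ τ.vertexSide (τ.inv f)) →
      (w ∈ τ.vertexSide f ∨ w ∈ τ.vertexSide (τ.inv f)) := by
    rintro w u (h | rfl | rfl | rfl) hu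
    · refine hu.imp (fun hu => ?_) (fun hu => ?_)
      · exact Relation.ReflTransGen.head h hu
      · exact Relation.ReflTransGen.head (sideAdj_inv f ▸ h) hu
    · exact hu
    · exact Or.inl (bd_mem_vertexSide f)
    · exact Or.inr (bd_mem_vertexSide _)
  induction τ.conn v (τ.bd f) using Relation.ReflTransGen.head_induction_on with
  | refl => exact Or.inl (bd_mem_vertexSide f)
  | head h _ ih =>
    refine key _ _ ?_ ih
    obtain ⟨k, rfl, rfl⟩ := h
    by_cases h1 : k = f
    · simp [h1]
    · by_cases h2 : k = τ.inv f
      · simp [h2]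
      · exact Or.inl ⟨k, h1, h2, rfl, rfl⟩

lemma vertexSide_inv {f : τ.Fl} (hf : τ.inv f ≠ f) :
    τ.vertexSide (τ.inv f) = (τ.vertexSide f)ᶜ := by
  ext v
  refine ⟨fun h h' => bd_inv_notMem_vertexSide hf ?_,
    fun h => (mem_vertexSide_or f v).resolve_left h⟩
  have h : Relation.ReflTransGen (τ.sideAdj (τ.inv f)) v (τ.bd (τ.inv f)) := h
  rw [sideAdj_inv] at h
  exact (reflTransGen_sideAdj_symm h).trans h'

lemma flagSide_inv {f : τ.Fl} (hf : τ.inv f ≠ f) : τ.flagSide (τ.inv f) = (τ.flagSide f)ᶜ := by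
  ext s
  rw [mem_flagSide, vertexSide_inv hf]
  rfl

lemma flagPartition_inv (f : τ.Fl) : τ.flagPartition (τ.inv f) = τ.flagPartition f := by
  rw [flagPartition, flagPartition, τ.inv_inv, Set.pair_comm]

lemma flagPartition_eq {f : τ.Fl} (hf : τ.inv f ≠ f) :
    τ.flagPartition f = {τ.flagSide f, (τ.flagSide f)ᶜ} := by
  rw [flagPartition, flagSide_inv hf]

lemma bd_inv_mem_vertexSide {f g : τ.Fl} (h1 : g ≠ f) (h2 : g ≠ τ.inv f)
    (h : τ.bd g ∈ τ.vertexSide f) : τ.bd (τ.inv g) ∈ τ.vertexSide f :=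
  Relation.ReflTransGen.head (sideAdj_symm ⟨g, h1, h2, rfl, rfl⟩) h

/-- If `f` and `g` face each other, then the part behind `g` lies on the `f`-side. -/
lemma vertexSide_inv_subset {f g : τ.Fl} (hg : τ.inv g ≠ g)
    (h1 : g ≠ f) (h2 : g ≠ τ.inv f) (hgf : τ.bd g ∈ τ.vertexSide f)
    (hfg : τ.bd f ∈ τ.vertexSide g) : τ.vertexSide (τ.inv g) ⊆ τ.vertexSide f := by
  have h3 : f ≠ τ.inv g := by
    rintro rfl
    exact h2 (τ.inv_inv g).symm
  have hfg' := bd_inv_mem_vertexSide h1.symm h3 hfg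
  intro v hv
  induction hv using Relation.ReflTransGen.head_induction_on with
  | refl => exact bd_inv_mem_vertexSide h1 h2 hgf
  | head h hc ih =>
    have ha := Relation.ReflTransGen.head h hc
    obtain ⟨k, _, _, rfl, rfl⟩ := h
    have ha : τ.bd k ∈ τ.vertexSide (τ.inv g) := ha
    rw [vertexSide_inv hg] at ha
    refine Relation.ReflTransGen.head ⟨k, ?_, ?_, rfl, rfl⟩ ih
    · rintro rfl
      exact ha hfg
    · rintro rfl
      exact ha hfg'

lemma ne_inv_of_bd_eq {f g : τ.Fl} (hf : τ.inv f ≠ f) (h : τ.bd g = τ.bd f) : g ≠ τ.inv f := by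
  rintro rfl
  exact bd_inv_notMem_vertexSide hf (h ▸ bd_mem_vertexSide f)

lemma vertexSide_inv_subset_of_bd_eq {f g : τ.Fl} (hf : τ.inv f ≠ f) (hg : τ.inv g ≠ g)
    (hne : g ≠ f) (h : τ.bd g = τ.bd f) : τ.vertexSide (τ.inv g) ⊆ τ.vertexSide f :=
  vertexSide_inv_subset hg hne (ne_inv_of_bd_eq hf h) (h ▸ bd_mem_vertexSide f)
    (h ▸ bd_mem_vertexSide g)

/-- Each side of an edge contains an end vertex. -/
lemma exists_end_mem_vertexSide {f : τ.Fl} (hf : τ.inv f ≠ f) :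
    ∃ v ∈ τ.vertexSide f, Nat.card {g : τ.Fl // τ.bd g = v ∧ τ.inv g ≠ g} ≤ 1 := by
  induction hn : (τ.vertexSide f).ncard using Nat.strong_induction_on generalizing f with
  | _ n ih =>
    by_cases hc : Nat.card {g : τ.Fl // τ.bd g = τ.bd f ∧ τ.inv g ≠ g} ≤ 1
    · exact ⟨_, bd_mem_vertexSide f, hc⟩
    · obtain ⟨g, ⟨hgb, hg⟩, hgf⟩ := Set.exists_ne_of_one_lt_ncard
        (s := {g : τ.Fl | τ.bd g = τ.bd f ∧ τ.inv g ≠ g}) (not_le.1 hc) f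
      have hsub := vertexSide_inv_subset_of_bd_eq hf hg hgf hgb
      have hss : τ.vertexSide (τ.inv g) ⊂ τ.vertexSide f := by
        refine ⟨hsub, fun h => ?_⟩
        have := h (bd_mem_vertexSide f)
        rw [vertexSide_inv hg, ← hgb] at this
        exact this (bd_mem_vertexSide g)
      obtain ⟨v, hv, hv'⟩ := ih _ (hn ▸ Set.ncard_lt_ncard hss (Set.toFinite _))
        (inv_inv_ne hg) rfl
      exact ⟨v, hsub hv, hv'⟩

variable {W : Set γ}

lemma PaintedStable.exists_white_mem_flagSide (hτ : τ.PaintedStable W) {f : τ.Fl}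
    (hf : τ.inv f ≠ f) : (τ.flagSide f ∩ W).Nonempty := by
  obtain ⟨v, hv, hv'⟩ := exists_end_mem_vertexSide hf
  obtain ⟨s, hs, rfl⟩ := hτ.2 v hv'
  exact ⟨s, hv, hs⟩

lemma PaintedStable.two_le_ncard_flagSide [Finite γ] (hτ : τ.PaintedStable W) {f : τ.Fl}
    (hf : τ.inv f ≠ f) : 2 ≤ (τ.flagSide f).ncard := by
  obtain ⟨v, hv, hv'⟩ := exists_end_mem_vertexSide hf
  have h3 : 3 ≤ {g : τ.Fl | τ.bd g = v}.ncard := hτ.1 v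
  have h1 : {g : τ.Fl | τ.bd g = v ∧ τ.inv g ≠ g}.ncard ≤ 1 := hv'
  have hsub : {g : τ.Fl | τ.bd g = v} ⊆
      {g : τ.Fl | τ.bd g = v ∧ τ.inv g ≠ g} ∪ τ.label '' τ.flagSide f := by
    intro g hg
    by_cases h : τ.inv g = g
    · obtain ⟨s, rfl⟩ := τ.label_surj g h
      refine Or.inr ⟨s, ?_, rfl⟩
      have hg : τ.bd (τ.label s) = v := hg
      rw [mem_flagSide, hg]
      exact hv
    · exact Or.inl ⟨hg, h⟩
  have hle := (Set.ncard_le_ncard hsub (Set.toFinite _)).trans (Set.ncard_union_le _ _)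
  rw [Set.ncard_image_of_injective _ τ.label_inj] at hle
  omega

lemma PaintedStable.paintedStablePart_flagPartition [Finite γ] (hτ : τ.PaintedStable W)
    {f : τ.Fl} (hf : τ.inv f ≠ f) : PaintedStablePart W (τ.flagPartition f) := by
  refine ⟨⟨τ.flagSide f, τ.flagSide (τ.inv f), rfl, ?_, ?_, ?_, ?_, ?_⟩, ?_⟩
  · obtain ⟨s, hs, -⟩ := hτ.exists_white_mem_flagSide hf
    intro h
    rw [flagSide_inv hf] at h
    exact (h ▸ hs : s ∈ (τ.flagSide f)ᶜ) hs
  · exact (hτ.exists_white_mem_flagSide hf).left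
  · exact (hτ.exists_white_mem_flagSide (inv_inv_ne hf)).left
  · rw [flagSide_inv hf]
    exact disjoint_compl_right
  · rw [flagSide_inv hf, Set.union_compl_self]
  · rintro A (rfl | rfl)
    · exact ⟨hτ.exists_white_mem_flagSide hf, hτ.two_le_ncard_flagSide hf⟩
    · exact ⟨hτ.exists_white_mem_flagSide (inv_inv_ne hf),
        hτ.two_le_ncard_flagSide (inv_inv_ne hf)⟩

/-- There is a tail between two distinct edges facing each other. -/
lemma PaintedStable.flagSide_inter_nonempty (hτ : τ.PaintedStable W) {f g : τ.Fl}
    (hf : τ.inv f ≠ f) (hg : τ.inv g ≠ g) (hfg : τ.bd f ∈ τ.vertexSide g) :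
    (τ.flagSide f ∩ τ.flagSide g).Nonempty := by
  have of_tail : ∀ k : τ.Fl, τ.bd k = τ.bd f → τ.inv k = k →
      (τ.flagSide f ∩ τ.flagSide g).Nonempty := by
    intro k hk hki
    obtain ⟨s, rfl⟩ := τ.label_surj k hki
    exact ⟨s, mem_flagSide.2 (hk ▸ bd_mem_vertexSide f), mem_flagSide.2 (hk ▸ hfg)⟩
  have of_edge : ∀ k : τ.Fl, τ.bd k = τ.bd f → k ≠ f → τ.inv k ≠ k → k ≠ g →
      τ.bd g ∈ τ.vertexSide k → (τ.flagSide f ∩ τ.flagSide g).Nonempty := by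
    intro k hk hkf hki hkg hgk
    obtain ⟨s, hs, -⟩ := hτ.exists_white_mem_flagSide (inv_inv_ne hki)
    refine ⟨s, vertexSide_inv_subset_of_bd_eq hf hki hkf hk hs,
      vertexSide_inv_subset hki hkg ?_ (hk ▸ hfg) hgk hs⟩
    rintro rfl
    exact bd_inv_notMem_vertexSide hg (hk ▸ hfg)
  obtain ⟨k, l, hkl, hkf, hlf, hk, hl⟩ : ∃ k l : τ.Fl, k ≠ l ∧ k ≠ f ∧ l ≠ f ∧
      τ.bd k = τ.bd f ∧ τ.bd l = τ.bd f := by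
    have h3 : 3 ≤ {h : τ.Fl | τ.bd h = τ.bd f}.ncard := hτ.1 (τ.bd f)
    have h2 : 1 < ({h : τ.Fl | τ.bd h = τ.bd f} \ {f}).ncard := by
      rw [Set.ncard_sdiff_singleton_of_mem (show f ∈ {h : τ.Fl | τ.bd h = τ.bd f} from rfl)]
      omega
    obtain ⟨k, l, hk, hl, hkl⟩ := (Set.one_lt_ncard_iff (Set.toFinite _)).1 h2
    exact ⟨k, l, hkl, hk.2, hl.2, hk.1, hl.1⟩
  by_cases hki : τ.inv k = k
  · exact of_tail k hk hki
  by_cases hli : τ.inv l = l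
  · exact of_tail l hl hli
  by_cases hkg : k = g
  · refine of_edge l hl hlf hli (hkg ▸ hkl.symm) ?_
    rw [← hkg, hk, ← hl]
    exact bd_mem_vertexSide l
  by_cases hgk : τ.bd g ∈ τ.vertexSide k
  · exact of_edge k hk hkf hki hkg hgk
  · have hgk' := (mem_vertexSide_or k (τ.bd g)).resolve_left hgk
    refine of_edge l hl hlf hli ?_
      (vertexSide_inv_subset_of_bd_eq hli hki hkl (hk.trans hl.symm) hgk')
    rintro rfl
    apply hgk
    rw [hl, ← hk]
    exact bd_mem_vertexSide k

/-- Two edges can be oriented so that they face each other. -/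
lemma exists_facing {f g : τ.Fl} (hf : τ.inv f ≠ f) (hg : τ.inv g ≠ g) (h1 : g ≠ f)
    (h2 : g ≠ τ.inv f) :
    ∃ f' g' : τ.Fl, τ.inv f' ≠ f' ∧ τ.inv g' ≠ g' ∧ τ.flagPartition f' = τ.flagPartition f ∧
      τ.flagPartition g' = τ.flagPartition g ∧ g' ≠ f' ∧ g' ≠ τ.inv f' ∧
      τ.bd g' ∈ τ.vertexSide f' ∧ τ.bd f' ∈ τ.vertexSide g' := by
  obtain ⟨f', hf', hp, h1, h2, hgf⟩ : ∃ f' : τ.Fl, τ.inv f' ≠ f' ∧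
      τ.flagPartition f' = τ.flagPartition f ∧ g ≠ f' ∧ g ≠ τ.inv f' ∧
      τ.bd g ∈ τ.vertexSide f' := by
    rcases mem_vertexSide_or f (τ.bd g) with h | h
    · exact ⟨f, hf, rfl, h1, h2, h⟩
    · exact ⟨τ.inv f, inv_inv_ne hf, flagPartition_inv f, h2, by rwa [τ.inv_inv], h⟩
  rcases mem_vertexSide_or g (τ.bd f') with h | h
  · exact ⟨f', g, hf', hg, hp, rfl, h1, h2, hgf, h⟩
  · refine ⟨f', τ.inv g, hf', inv_inv_ne hg, hp, flagPartition_inv g, ?_, ?_,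
      bd_inv_mem_vertexSide h1 h2 hgf, h⟩
    · rintro rfl
      exact h2 (τ.inv_inv g).symm
    · intro h'
      apply h1
      rw [← τ.inv_inv g, h', τ.inv_inv]

lemma PaintedStable.delta_flagPartition (hτ : τ.PaintedStable W) {f g : τ.Fl}
    (hf : τ.inv f ≠ f) (hg : τ.inv g ≠ g) (h1 : g ≠ f) (h2 : g ≠ τ.inv f) :
    delta (τ.flagPartition g) (τ.flagPartition f) = 1 := by
  obtain ⟨f', g', hf', hg', hpf, hpg, h1, h2, hgf, hfg⟩ := exists_facing hf hg h1 h2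
  rw [← hpf, ← hpg, flagPartition_eq hf', flagPartition_eq hg']
  refine delta_pair_compl ?_ ?_ ?_ ?_
  · rw [← flagSide_inv hg']
    exact (hτ.exists_white_mem_flagSide (inv_inv_ne hg')).left
  · rw [← flagSide_inv hf']
    exact (hτ.exists_white_mem_flagSide (inv_inv_ne hf')).left
  · rw [Set.inter_comm]
    exact hτ.flagSide_inter_nonempty hf' hg' hfg
  · rw [← flagSide_inv hg']
    exact fun s hs => vertexSide_inv_subset hg' h1 h2 hgf hfg hs

end LTree

/-- For any painted stable `S`-tree `τ`, distinct edges determine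
distinct 2-partitions `σ_e` of `S`, and the family `{σ_e : e ∈ E_τ}` is a good family
of painted stable 2-partitions. -/
theorem edgeFamily_good {γ : Type} [Finite γ] (W : Set γ)
    (τ : LTree γ) (hτ : τ.PaintedStable W) :
    (∀ f g : τ.Fl, τ.inv f ≠ f → τ.inv g ≠ g →
      τ.flagPartition f = τ.flagPartition g → g = f ∨ g = τ.inv f) ∧
    GoodFamily W τ.edgeFamily := by
  have hinj : ∀ f g : τ.Fl, τ.inv f ≠ f → τ.inv g ≠ g →
      τ.flagPartition f = τ.flagPartition g → g = f ∨ g = τ.inv f := by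
    intro f g hf hg h
    by_contra! hne
    have h1 := hτ.delta_flagPartition hf hg hne.1 hne.2
    rw [← h, LTree.flagPartition_eq hf] at h1
    have h0 := delta_pair_compl_self_le (τ.flagSide f)
    omega
  refine ⟨hinj, ?_, ?_⟩
  · rintro σ ⟨f, hf, rfl⟩
    exact hτ.paintedStablePart_flagPartition hf
  · rintro σ ⟨f, hf, rfl⟩ σ' ⟨g, hg, rfl⟩ hne
    refine hτ.delta_flagPartition hg hf ?_ ?_
    · rintro rfl
      exact hne rfl
    · rintro rfl
      exact hne (LTree.flagPartition_inv g)

end EMO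
end
end

section
/- Let E′ be a nonempty good family of painted stable 2-partitions of S, let σ ∈ E′ and E = E′ ∖ {σ}. Let τ′ and τ be the painted stable S-trees corresponding to E′ and E respectively, and let e be the edge of τ′ with σ_e = σ. Then there is a unique S-morphism τ′ → τ contracting e and inducing on edge 2-partitions the tautological inclusion E ⊆ E′. -/
open scoped Classical
noncomputable section

namespace EMO

namespace LTree

variable {γ : Type} (τ : LTree γ)

/-- the two sides of every edge carry complementary nonempty sets of labels. -/
def Splits : Prop :=
  ∀ f, τ.inv f ≠ f → (τ.flagSide f).Nonempty ∧ τ.flagSide (τ.inv f) = (τ.flagSide f)ᶜ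

variable {τ}

lemma flagSide_mono {f g : τ.Fl} (h : τ.vertexSide f ⊆ τ.vertexSide g) :
    τ.flagSide f ⊆ τ.flagSide g := fun _ hs => h hs

lemma inv_injective : Function.Injective τ.inv :=
  Function.LeftInverse.injective τ.inv_inv

lemma bd_mem_of_bd_inv_mem {f g : τ.Fl} (h₁ : g ≠ f) (h₂ : g ≠ τ.inv f)
    (h : τ.bd (τ.inv g) ∈ τ.vertexSide f) : τ.bd g ∈ τ.vertexSide f :=
  Relation.ReflTransGen.head ⟨g, h₁, h₂, rfl, rfl⟩ h

lemma bd_inv_mem_of_bd_mem {f g : τ.Fl} (h₁ : g ≠ f) (h₂ : g ≠ τ.inv f)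
    (h : τ.bd g ∈ τ.vertexSide f) : τ.bd (τ.inv g) ∈ τ.vertexSide f := by
  refine bd_mem_of_bd_inv_mem (fun e => h₂ ?_) (fun e => h₁ (inv_injective e)) ?_
  · rw [← e, τ.inv_inv]
  · rwa [τ.inv_inv]

/-- An edge which does not lie inside the `f`-side does not separate vertices of the `f`-side. -/
lemma mem_vertexSide_iff {f h : τ.Fl}
    (hh : ¬(τ.bd h ∈ τ.vertexSide f ∧ τ.bd (τ.inv h) ∈ τ.vertexSide f))
    {x : τ.V} (hx : x ∈ τ.vertexSide f) :
    x ∈ τ.vertexSide h ↔ τ.bd f ∈ τ.vertexSide h := by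
  induction hx using Relation.ReflTransGen.head_induction_on with
  | refl => rfl
  | @head a b hab hb ih =>
    have ha : a ∈ τ.vertexSide f := Relation.ReflTransGen.head hab hb
    have hb : b ∈ τ.vertexSide f := hb
    obtain ⟨g, -, -, rfl, rfl⟩ := hab
    have h₁ : g ≠ h := by
      rintro rfl
      exact hh ⟨ha, hb⟩
    have h₂ : g ≠ τ.inv h := by
      rintro rfl
      rw [τ.inv_inv] at hb
      exact hh ⟨hb, ha⟩
    rw [← ih]
    exact ⟨bd_inv_mem_of_bd_mem h₁ h₂, bd_mem_of_bd_inv_mem h₁ h₂⟩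

lemma vertexSide_subset {f h : τ.Fl} (h₁ : τ.bd h ∉ τ.vertexSide f)
    (h₂ : τ.bd f ∈ τ.vertexSide h) : τ.vertexSide f ⊆ τ.vertexSide h :=
  fun _ hx => (mem_vertexSide_iff (fun h => h₁ h.1) hx).2 h₂

lemma exists_flag_mem_vertexSide {v w : τ.V} (hvw : w ≠ v) :
    ∃ k, τ.inv k ≠ k ∧ τ.bd k = v ∧ w ∈ τ.vertexSide (τ.inv k) := by
  induction τ.conn v w with
  | refl => exact absurd rfl hvw
  | @tail a b _ hab ih =>
    obtain ⟨m, rfl, rfl⟩ := hab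
    by_cases hm : τ.bd m = v
    · exact ⟨m, fun e => hvw (by rw [e, hm]), hm, bd_mem_vertexSide _⟩
    · obtain ⟨k, hk, rfl, hmem⟩ := ih hm
      refine ⟨k, hk, rfl, bd_inv_mem_of_bd_mem ?_ ?_ hmem⟩
      · rintro rfl
        exact hvw (by rw [τ.inv_inv])
      · rw [τ.inv_inv]
        rintro rfl
        exact hm rfl

lemma exists_two_flags (hv : ∀ v : τ.V, 3 ≤ Nat.card {f : τ.Fl // τ.bd f = v}) (v : τ.V)
    (a : τ.Fl) : ∃ h k, h ≠ k ∧ h ≠ a ∧ k ≠ a ∧ τ.bd h = v ∧ τ.bd k = v := by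
  have h := hv v
  have : Fintype {f : τ.Fl // τ.bd f = v} := Fintype.ofFinite _
  rw [Nat.card_eq_fintype_card] at h
  obtain ⟨⟨x, hx⟩, ⟨y, hy⟩, ⟨z, hz⟩, hxy, hxz, hyz⟩ := Fintype.two_lt_card_iff.1 h
  simp only [ne_eq, Subtype.mk.injEq] at hxy hxz hyz
  by_cases hax : x = a
  · exact ⟨y, z, by grind⟩
  by_cases hay : y = a
  · exact ⟨x, z, by grind⟩
  · exact ⟨x, y, by grind⟩

lemma exists_flag_ne (hv : ∀ v : τ.V, 3 ≤ Nat.card {f : τ.Fl // τ.bd f = v}) (v : τ.V)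
    (a b : τ.Fl) : ∃ h, τ.bd h = v ∧ h ≠ a ∧ h ≠ b := by
  obtain ⟨h, k, hhk, hha, hka, rfl, hk⟩ := exists_two_flags hv v a
  by_cases hb : h = b
  · exact ⟨k, hk, hka, fun e => hhk (hb.trans e.symm)⟩
  · exact ⟨h, rfl, hha, hb⟩

lemma splits_of_goodFamily {W : Set γ} {E : Set (Set (Set γ))} (hE : GoodFamily W E)
    (hτ : τ.edgeFamily ⊆ E) : τ.Splits := by
  intro f hf
  obtain ⟨⟨A, B, hAB, hne, hA, hB, hd, hu⟩, -⟩ := hE.1 _ (hτ ⟨f, hf, rfl⟩)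
  have hBA : B = Aᶜ := (IsCompl.compl_eq ⟨hd, codisjoint_iff.2 hu⟩).symm
  have hAB' : A = Bᶜ := by rw [hBA, compl_compl]
  rcases Set.pair_eq_pair_iff.1 hAB with ⟨h₁, h₂⟩ | ⟨h₁, h₂⟩
  · exact ⟨h₁ ▸ hA, by rw [h₁, h₂, hBA]⟩
  · exact ⟨h₁ ▸ hB, by rw [h₁, h₂]; exact hAB'⟩

lemma Splits.not_mem_inv (hs : τ.Splits) {f : τ.Fl} (hf : τ.inv f ≠ f) {v : τ.V}
    (h₁ : v ∈ τ.vertexSide f) : v ∉ τ.vertexSide (τ.inv f) := by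
  intro h₂
  obtain ⟨⟨s, hsf⟩, hc⟩ := hs f hf
  have key : ∀ {a b : τ.V}, Relation.ReflTransGen (τ.sideAdj f) a b →
      Relation.ReflTransGen (τ.sideAdj f) b a := by
    have : Std.Symm (τ.sideAdj f) := by
      refine ⟨?_⟩
      rintro x y ⟨g, hg₁, hg₂, rfl, rfl⟩
      exact ⟨τ.inv g, fun e => hg₂ (by rw [← e, τ.inv_inv]), fun e => hg₁ (inv_injective e), rfl,
        by rw [τ.inv_inv]⟩
    exact fun {_ _} hab => Std.Symm.symm _ _ hab
  have hadj : ∀ {a b : τ.V}, τ.sideAdj f a b → τ.sideAdj (τ.inv f) a b := by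
    rintro a b ⟨g, hg₁, hg₂, rfl, rfl⟩
    exact ⟨g, hg₂, by rwa [τ.inv_inv], rfl, rfl⟩
  have : s ∈ τ.flagSide (τ.inv f) :=
    (Relation.ReflTransGen.mono (fun _ _ => hadj) _ _
      ((mem_flagSide.1 hsf).trans (key h₁))).trans h₂
  rw [hc] at this
  exact this hsf

lemma Splits.mem_inv_iff (hs : τ.Splits) {f : τ.Fl} (hf : τ.inv f ≠ f) {v : τ.V} :
    v ∈ τ.vertexSide (τ.inv f) ↔ v ∉ τ.vertexSide f :=
  ⟨fun h h' => hs.not_mem_inv hf h' h, (mem_vertexSide_or f v).resolve_left⟩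

lemma Splits.subset_or_of_mem (hs : τ.Splits) {f h : τ.Fl} (hf : τ.inv f ≠ f)
    (h₁ : f ≠ h) (h₂ : f ≠ τ.inv h) (hm : τ.bd f ∈ τ.vertexSide h) :
    τ.vertexSide f ⊆ τ.vertexSide h ∨ τ.vertexSide (τ.inv f) ⊆ τ.vertexSide h := by
  by_cases hb : τ.bd h ∈ τ.vertexSide f
  · exact Or.inr (vertexSide_subset (hs.not_mem_inv hf hb) (bd_inv_mem_of_bd_mem h₁ h₂ hm))
  · exact Or.inl (vertexSide_subset hb hm)

lemma Splits.vertexSide_inv_subset (hs : τ.Splits) {h k : τ.Fl} (hh : τ.inv h ≠ h)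
    (hne : h ≠ k) (hb : τ.bd h = τ.bd k) : τ.vertexSide (τ.inv h) ⊆ τ.vertexSide k := by
  have hm := bd_mem_vertexSide h
  refine vertexSide_subset (hb ▸ hs.not_mem_inv hh hm) ?_
  refine bd_inv_mem_of_bd_mem hne ?_ (hb ▸ bd_mem_vertexSide k)
  intro e
  have e' : τ.inv h = k := by rw [e, τ.inv_inv]
  exact hs.not_mem_inv hh hm (by rw [e', hb]; exact bd_mem_vertexSide k)

/-- In a tree with at least three flags at every vertex, if all labels on the `g`-side lie on the
`f`-side, then `g` is rooted on the `f`-side. -/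
lemma Splits.bd_mem_of_flagSide_subset (hs : τ.Splits)
    (hv : ∀ v : τ.V, 3 ≤ Nat.card {f : τ.Fl // τ.bd f = v}) {f g : τ.Fl}
    (hsub : τ.flagSide g ⊆ τ.flagSide f) : τ.bd g ∈ τ.vertexSide f := by
  by_contra hg
  obtain ⟨h, k, hhk, hhg, hkg, hh, hk⟩ := exists_two_flags hv (τ.bd g) g
  have key : ∀ h, h ≠ g → τ.bd h = τ.bd g →
      τ.inv h ≠ h ∧ τ.bd f ∈ τ.vertexSide (τ.inv h) := by
    intro h hne hb
    have he : τ.inv h ≠ h := by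
      intro e
      obtain ⟨s, rfl⟩ := τ.label_surj h e
      have : s ∈ τ.flagSide g := by
        rw [mem_flagSide, hb]; exact bd_mem_vertexSide g
      exact hg (hb ▸ mem_flagSide.1 (hsub this))
    refine ⟨he, ?_⟩
    obtain ⟨s, hsm⟩ := (hs _ (inv_inv_ne he)).1
    have hsf := hsub (flagSide_mono (hs.vertexSide_inv_subset he hne hb) hsm)
    refine (mem_vertexSide_iff ?_ (mem_flagSide.1 hsf)).1 hsm
    rw [τ.inv_inv, hb]
    exact fun h' => hg h'.2
  obtain ⟨hhe, hhf⟩ := key h hhg hh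
  obtain ⟨hke, hkf⟩ := key k hkg hk
  exact hs.not_mem_inv hke (hs.vertexSide_inv_subset hhe hhk (hh.trans hk.symm) hhf) hkf

lemma Splits.flagSide_injOn (hs : τ.Splits)
    (hv : ∀ v : τ.V, 3 ≤ Nat.card {f : τ.Fl // τ.bd f = v}) {f g : τ.Fl}
    (hf : τ.inv f ≠ f) (hg : τ.inv g ≠ g) (hfg : τ.flagSide f = τ.flagSide g) : f = g := by
  have hgf := hs.bd_mem_of_flagSide_subset hv hfg.ge
  have hinv : τ.flagSide (τ.inv f) = τ.flagSide (τ.inv g) := by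
    rw [(hs f hf).2, (hs g hg).2, hfg]
  have hgf' := hs.bd_mem_of_flagSide_subset hv hinv.ge
  by_contra hne
  refine hs.not_mem_inv hf (bd_inv_mem_of_bd_mem (Ne.symm hne) ?_ hgf) hgf'
  rintro rfl
  exact hs.not_mem_inv hf hgf (bd_mem_vertexSide _)

/-- Whether an edge flag is rooted on a given side of another edge is determined by the labels. -/
lemma Splits.bd_mem_iff (hs : τ.Splits)
    (hv : ∀ v : τ.V, 3 ≤ Nat.card {f : τ.Fl // τ.bd f = v}) {f h : τ.Fl}
    (hf : τ.inv f ≠ f) (h₁ : f ≠ h) (h₂ : f ≠ τ.inv h) :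
    τ.bd f ∈ τ.vertexSide h ↔
      τ.flagSide f ⊆ τ.flagSide h ∨ τ.flagSide (τ.inv f) ⊆ τ.flagSide h := by
  constructor
  · intro hm
    exact (hs.subset_or_of_mem hf h₁ h₂ hm).imp flagSide_mono flagSide_mono
  · rintro (hsub | hsub)
    · exact hs.bd_mem_of_flagSide_subset hv hsub
    · exact bd_mem_of_bd_inv_mem h₁ h₂ (hs.bd_mem_of_flagSide_subset hv hsub)

/-- a map between the flags of labeled trees which respects tails with their labels and edge
flags with the sets of labels on their sides. -/
structure SidePreserving {τ τ' : LTree γ} (F : τ.Fl → τ'.Fl) : Prop where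
  map_label : ∀ s, F (τ.label s) = τ'.label s
  map_edge : ∀ f, τ.inv f ≠ f → τ'.inv (F f) ≠ F f
  flagSide_map : ∀ f, τ.inv f ≠ f → τ'.flagSide (F f) = τ.flagSide f

namespace SidePreserving

variable {τ' : LTree γ} {F : τ.Fl → τ'.Fl}

lemma map_eq_tail (hF : SidePreserving F) {f : τ.Fl} (hf : τ.inv f = f) :
    τ'.inv (F f) = F f := by
  obtain ⟨s, rfl⟩ := τ.label_surj f hf
  rw [hF.map_label, τ'.label_fixed]

lemma injective (hF : SidePreserving F) (hs : τ.Splits)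
    (hv : ∀ v : τ.V, 3 ≤ Nat.card {f : τ.Fl // τ.bd f = v}) : Function.Injective F := by
  intro f g hfg
  by_cases hf : τ.inv f = f <;> by_cases hg : τ.inv g = g
  · obtain ⟨s, rfl⟩ := τ.label_surj f hf
    obtain ⟨t, rfl⟩ := τ.label_surj g hg
    rw [hF.map_label, hF.map_label] at hfg
    rw [τ'.label_inj hfg]
  · exact absurd (hfg ▸ hF.map_eq_tail hf) (hF.map_edge g hg)
  · exact absurd (hfg ▸ hF.map_eq_tail hg) (hF.map_edge f hf)
  · refine hs.flagSide_injOn hv hf hg ?_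
    rw [← hF.flagSide_map f hf, ← hF.flagSide_map g hg, hfg]

lemma map_inv (hF : SidePreserving F) (hs : τ.Splits) (hs' : τ'.Splits)
    (hv' : ∀ v : τ'.V, 3 ≤ Nat.card {f : τ'.Fl // τ'.bd f = v}) (f : τ.Fl) :
    F (τ.inv f) = τ'.inv (F f) := by
  by_cases hf : τ.inv f = f
  · rw [hf, hF.map_eq_tail hf]
  · have hf' := hF.map_edge f hf
    refine hs'.flagSide_injOn hv' (hF.map_edge _ (inv_inv_ne hf)) (inv_inv_ne hf') ?_
    rw [hF.flagSide_map _ (inv_inv_ne hf), (hs' _ hf').2, (hs f hf).2, hF.flagSide_map f hf]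

lemma bd_mem_iff (hF : SidePreserving F) (hs : τ.Splits) (hs' : τ'.Splits)
    (hv : ∀ v : τ.V, 3 ≤ Nat.card {f : τ.Fl // τ.bd f = v})
    (hv' : ∀ v : τ'.V, 3 ≤ Nat.card {f : τ'.Fl // τ'.bd f = v}) {f h : τ.Fl}
    (hh : τ.inv h ≠ h) :
    τ'.bd (F f) ∈ τ'.vertexSide (F h) ↔ τ.bd f ∈ τ.vertexSide h := by
  by_cases hf : τ.inv f = f
  · obtain ⟨s, rfl⟩ := τ.label_surj f hf
    rw [hF.map_label, ← mem_flagSide, ← mem_flagSide, hF.flagSide_map h hh]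
  by_cases h₁ : f = h
  · subst h₁
    exact iff_of_true (bd_mem_vertexSide _) (bd_mem_vertexSide _)
  by_cases h₂ : f = τ.inv h
  · subst h₂
    rw [hF.map_inv hs hs' hv']
    exact iff_of_false
      (fun hm => hs'.not_mem_inv (hF.map_edge h hh) hm (bd_mem_vertexSide _))
      (fun hm => hs.not_mem_inv hh hm (bd_mem_vertexSide _))
  have hinj := hF.injective hs hv
  rw [hs.bd_mem_iff hv hf h₁ h₂, hs'.bd_mem_iff hv' (hF.map_edge f hf) (hinj.ne h₁)
    (by rw [← hF.map_inv hs hs' hv']; exact hinj.ne h₂), ← hF.map_inv hs hs' hv',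
    hF.flagSide_map f hf, hF.flagSide_map h hh, hF.flagSide_map _ (inv_inv_ne hf)]

end SidePreserving

/-- Distinct vertices separated by no edge other than the one of `e` are the ends of `e`. -/
lemma Splits.eq_bd_of_separated (hs : τ.Splits) {e : τ.Fl} (he : τ.inv e ≠ e) {v w : τ.V}
    (hsep : ∀ h, τ.inv h ≠ h → v ∈ τ.vertexSide h → w ∈ τ.vertexSide (τ.inv h) →
      h = e ∨ h = τ.inv e)
    (hve : v ∈ τ.vertexSide e) (hwe : w ∈ τ.vertexSide (τ.inv e)) : v = τ.bd e := by
  by_contra hne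
  obtain ⟨k, hk, hkb, hvk⟩ := exists_flag_mem_vertexSide hne
  have hk₁ : k ≠ e := by
    rintro rfl
    exact hs.not_mem_inv hk hve hvk
  have hsub := hs.vertexSide_inv_subset hk hk₁ hkb
  have hwk : w ∈ τ.vertexSide (τ.inv (τ.inv k)) := by
    rw [τ.inv_inv]
    by_contra hwk
    exact hs.not_mem_inv he (hsub ((hs.mem_inv_iff hk).2 hwk)) hwe
  rcases hsep _ (inv_inv_ne hk) hvk hwk with h | h
  · exact hs.not_mem_inv hk (v := τ.bd e) (hkb ▸ bd_mem_vertexSide k) (h ▸ bd_mem_vertexSide _)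
  · exact hk₁ (inv_injective h)

lemma Splits.pair_eq_of_separated (hs : τ.Splits) {e : τ.Fl} (he : τ.inv e ≠ e) {v w : τ.V}
    (hvw : v ≠ w)
    (hsep : ∀ h, τ.inv h ≠ h → v ∈ τ.vertexSide h → w ∈ τ.vertexSide (τ.inv h) →
      h = e ∨ h = τ.inv e) :
    ({v, w} : Set τ.V) = {τ.bd e, τ.bd (τ.inv e)} := by
  have hsep' : ∀ h, τ.inv h ≠ h → w ∈ τ.vertexSide h → v ∈ τ.vertexSide (τ.inv h) →
      h = e ∨ h = τ.inv e := by
    intro h hh hw hv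
    rcases hsep (τ.inv h) (inv_inv_ne hh) hv (by rwa [τ.inv_inv]) with h' | h'
    · right; rw [← h', τ.inv_inv]
    · exact Or.inl (inv_injective h')
  have key : ∀ {v w : τ.V}, (∀ h, τ.inv h ≠ h → v ∈ τ.vertexSide h →
      w ∈ τ.vertexSide (τ.inv h) → h = e ∨ h = τ.inv e) →
      (∀ h, τ.inv h ≠ h → w ∈ τ.vertexSide h → v ∈ τ.vertexSide (τ.inv h) →
      h = e ∨ h = τ.inv e) → v ∈ τ.vertexSide e → w ∈ τ.vertexSide (τ.inv e) →
      v = τ.bd e ∧ w = τ.bd (τ.inv e) := by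
    intro v w h₁ h₂ hv hw
    refine ⟨hs.eq_bd_of_separated he h₁ hv hw,
      hs.eq_bd_of_separated (inv_inv_ne he) ?_ hw (by rwa [τ.inv_inv])⟩
    intro h hh hw hv
    rw [τ.inv_inv]
    exact (h₂ h hh hw hv).symm
  obtain ⟨k, hk, rfl, hwk⟩ := exists_flag_mem_vertexSide hvw.symm
  rcases hsep k hk (bd_mem_vertexSide k) hwk with rfl | rfl
  · obtain ⟨-, h₂⟩ := key hsep hsep' (bd_mem_vertexSide k) hwk
    rw [h₂]
  · rw [τ.inv_inv] at hwk
    obtain ⟨h₁, -⟩ := key hsep' hsep hwk (bd_mem_vertexSide _)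
    rw [h₁, Set.pair_comm]

end LTree

namespace Contraction

open LTree

variable {γ : Type} {τ τ' : LTree γ} {e : τ'.Fl}

lemma cF_edge (c : Contraction τ' τ e) {f : τ.Fl} (hf : τ.inv f ≠ f) :
    τ'.inv (c.cF f) ≠ c.cF f := by
  rw [← c.cF_inv]
  exact c.cF_inj.ne hf

lemma flagSide_cF_subset (c : Contraction τ' τ e) (f : τ.Fl) :
    τ'.flagSide (c.cF f) ⊆ τ.flagSide f := by
  intro s hs
  have key : ∀ v, v ∈ τ'.vertexSide (c.cF f) → c.cV v ∈ τ.vertexSide f := by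
    intro v hv
    induction hv using Relation.ReflTransGen.head_induction_on with
    | refl => rw [c.cV_bd]; exact bd_mem_vertexSide f
    | head hab _ ih =>
      obtain ⟨g, h₁, h₂, rfl, rfl⟩ := hab
      by_cases hg₁ : g = e
      · subst hg₁; rwa [c.cV_glue]
      by_cases hg₂ : g = τ'.inv e
      · rw [hg₂, τ'.inv_inv] at ih
        rwa [hg₂, ← c.cV_glue]
      obtain ⟨k, rfl⟩ : g ∈ Set.range c.cF := by
        rw [c.cF_range]; exact ⟨hg₁, hg₂⟩
      rw [← c.cF_inv, c.cV_bd] at ih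
      rw [c.cV_bd]
      refine bd_mem_of_bd_inv_mem (fun e => h₁ (e ▸ rfl)) (fun e => h₂ ?_) ih
      rw [e, c.cF_inv]
  have := key _ (mem_flagSide.1 hs)
  rwa [← c.cF_label, c.cV_bd] at this

lemma sidePreserving (c : Contraction τ' τ e) (hs : τ.Splits) (hs' : τ'.Splits) :
    SidePreserving c.cF := by
  refine ⟨c.cF_label, fun f hf => c.cF_edge hf, fun f hf => ?_⟩
  refine (c.flagSide_cF_subset f).antisymm ?_
  have h := c.flagSide_cF_subset (τ.inv f)
  rwa [c.cF_inv, (hs f hf).2, (hs' _ (c.cF_edge hf)).2, Set.compl_subset_compl] at h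

/-- Stable trees admit at most one contraction of a given edge. -/
lemma eq_of_stable (hs : τ.Splits) (hs' : τ'.Splits)
    (hv' : ∀ v : τ'.V, 3 ≤ Nat.card {f : τ'.Fl // τ'.bd f = v})
    (c d : Contraction τ' τ e) : c = d := by
  have hF : c.cF = d.cF := by
    have hc := c.sidePreserving hs hs'
    have hd := d.sidePreserving hs hs'
    funext f
    by_cases hf : τ.inv f = f
    · obtain ⟨s, rfl⟩ := τ.label_surj f hf
      rw [hc.map_label, hd.map_label]
    · refine hs'.flagSide_injOn hv' (c.cF_edge hf) (d.cF_edge hf) ?_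
      rw [hc.flagSide_map f hf, hd.flagSide_map f hf]
  have hV : c.cV = d.cV := by
    funext v
    obtain ⟨h, rfl, h₁, h₂⟩ := exists_flag_ne hv' v e (τ'.inv e)
    obtain ⟨k, rfl⟩ : h ∈ Set.range c.cF := by
      rw [c.cF_range]; exact ⟨h₁, h₂⟩
    rw [c.cV_bd, hF, d.cV_bd]
  cases c
  cases d
  simp only at hF hV
  subst hF hV
  rfl

end Contraction

namespace LTree

variable {γ : Type} {τ τ' : LTree γ}

lemma exists_of_mem_edgeFamily {f : τ.Fl} (h : τ.flagPartition f ∈ τ'.edgeFamily) :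
    ∃ f', τ'.inv f' ≠ f' ∧ τ'.flagSide f' = τ.flagSide f := by
  obtain ⟨f', hf', h⟩ := h
  rcases Set.pair_eq_pair_iff.1 h with ⟨h₁, -⟩ | ⟨h₁, h₂⟩
  · exact ⟨f', hf', h₁⟩
  · exact ⟨τ'.inv f', inv_inv_ne hf', h₂⟩

lemma Splits.flagPartition_congr (hs : τ.Splits) (hs' : τ'.Splits) {f : τ.Fl} {f' : τ'.Fl}
    (hf : τ.inv f ≠ f) (hf' : τ'.inv f' ≠ f') (h : τ'.flagSide f' = τ.flagSide f) :
    τ'.flagPartition f' = τ.flagPartition f := by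
  rw [flagPartition, flagPartition, (hs f hf).2, (hs' f' hf').2, h]

lemma exists_sidePreserving
    (hsub : τ.edgeFamily ⊆ τ'.edgeFamily) : ∃ F : τ.Fl → τ'.Fl, SidePreserving F := by
  have h : ∀ f : τ.Fl, ∃ f' : τ'.Fl, (∀ s, τ.label s = f → τ'.label s = f') ∧
      (τ.inv f ≠ f → τ'.inv f' ≠ f' ∧ τ'.flagSide f' = τ.flagSide f) := by
    intro f
    by_cases hf : τ.inv f = f
    · obtain ⟨s, rfl⟩ := τ.label_surj f hf
      exact ⟨τ'.label s, fun t ht => by rw [τ.label_inj ht], fun h => absurd hf h⟩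
    · obtain ⟨f', hf'⟩ := exists_of_mem_edgeFamily (hsub ⟨f, hf, rfl⟩)
      refine ⟨f', ?_, fun _ => hf'⟩
      rintro s rfl
      exact absurd (τ.label_fixed s) hf
  choose F hF using h
  exact ⟨F, fun s => ((hF _).1 s rfl).symm, fun f hf => ((hF f).2 hf).1,
    fun f hf => ((hF f).2 hf).2⟩

lemma SidePreserving.range_eq {F : τ.Fl → τ'.Fl} (hF : SidePreserving F) (hs : τ.Splits)
    (hs' : τ'.Splits) (hv' : ∀ v : τ'.V, 3 ≤ Nat.card {f : τ'.Fl // τ'.bd f = v})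
    {e : τ'.Fl} (he : τ'.inv e ≠ e)
    (hfam : τ.edgeFamily = τ'.edgeFamily \ {τ'.flagPartition e}) :
    Set.range F = {f | f ≠ e ∧ f ≠ τ'.inv e} := by
  have hpart : τ'.flagPartition (τ'.inv e) = τ'.flagPartition e := by
    rw [flagPartition, τ'.inv_inv, Set.pair_comm, flagPartition]
  ext f'
  constructor
  · rintro ⟨f, rfl⟩
    have key : ∀ e', τ'.inv e' ≠ e' → τ'.flagPartition e' = τ'.flagPartition e → F f ≠ e' := by
      rintro _ he' hp rfl
      have hf : τ.inv f ≠ f := fun hf => he' (hF.map_eq_tail hf)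
      have hmem : τ.flagPartition f ∈ τ.edgeFamily := ⟨f, hf, rfl⟩
      rw [hfam, ← hs.flagPartition_congr hs' hf he' (hF.flagSide_map f hf)] at hmem
      exact hmem.2 hp
    exact ⟨key e he rfl, key _ (inv_inv_ne he) hpart⟩
  · rintro ⟨h₁, h₂⟩
    by_cases hf' : τ'.inv f' = f'
    · obtain ⟨s, rfl⟩ := τ'.label_surj f' hf'
      exact ⟨_, hF.map_label s⟩
    · have hmem : τ'.flagPartition f' ∈ τ.edgeFamily := by
        rw [hfam]
        refine ⟨⟨f', hf', rfl⟩, fun hp => ?_⟩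
        rcases Set.pair_eq_pair_iff.1 hp with ⟨h, -⟩ | ⟨h, -⟩
        · exact h₁ (hs'.flagSide_injOn hv' hf' he h)
        · exact h₂ (hs'.flagSide_injOn hv' hf' (inv_inv_ne he) h)
      obtain ⟨f, hf, h⟩ := exists_of_mem_edgeFamily hmem
      refine ⟨f, hs'.flagSide_injOn hv' (hF.map_edge f hf) hf' ?_⟩
      rw [hF.flagSide_map f hf, h]

lemma SidePreserving.exists_contraction {F : τ.Fl → τ'.Fl} (hF : SidePreserving F)
    (hs : τ.Splits) (hs' : τ'.Splits)
    (hv : ∀ v : τ.V, 3 ≤ Nat.card {f : τ.Fl // τ.bd f = v})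
    (hv' : ∀ v : τ'.V, 3 ≤ Nat.card {f : τ'.Fl // τ'.bd f = v})
    {e : τ'.Fl} (he : τ'.inv e ≠ e) (hrange : Set.range F = {f | f ≠ e ∧ f ≠ τ'.inv e}) :
    ∃ c : Contraction τ' τ e, c.cF = F := by
  have hne : ∀ f, F f ≠ e ∧ F f ≠ τ'.inv e := fun f => by
    have : F f ∈ Set.range F := ⟨f, rfl⟩
    rwa [hrange] at this
  have hex : ∀ v, ∃ f, τ'.bd (F f) = v := by
    intro v
    obtain ⟨h, hb, h₁, h₂⟩ := exists_flag_ne hv' v e (τ'.inv e)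
    obtain ⟨f, rfl⟩ : h ∈ Set.range F := by rw [hrange]; exact ⟨h₁, h₂⟩
    exact ⟨f, hb⟩
  have hside : ∀ {f h : τ.Fl}, τ.inv h ≠ h →
      (τ'.bd (F f) ∈ τ'.vertexSide (F h) ↔ τ.bd f ∈ τ.vertexSide h) :=
    fun hh => hF.bd_mem_iff hs hs' hv hv' hh
  have heq : ∀ {f g : τ.Fl}, (∀ h, τ.inv h ≠ h → τ'.bd (F f) ∈ τ'.vertexSide (F h) →
      τ'.bd (F g) ∈ τ'.vertexSide (F h)) → τ.bd f = τ.bd g := by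
    intro f g hfg
    by_contra hne
    obtain ⟨k, hk, hkb, hm⟩ := exists_flag_mem_vertexSide (Ne.symm hne)
    exact hs.not_mem_inv hk
      ((hside hk).1 (hfg k hk ((hside hk).2 (hkb ▸ bd_mem_vertexSide k)))) hm
  choose p hp using hex
  refine ⟨{ cF := F
            cV := fun v => τ.bd (p v)
            cF_inj := hF.injective hs hv
            cF_range := hrange
            cF_inv := hF.map_inv hs hs' hv'
            cF_label := hF.map_label
            cV_surj := ?_
            cV_bd := ?_
            cV_glue := ?_
            cV_almost_inj := ?_ }, rfl⟩
  · intro v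
    obtain ⟨f, rfl, -, -⟩ := exists_flag_ne hv v (p (τ'.bd e)) (p (τ'.bd e))
    exact ⟨τ'.bd (F f), heq fun h _ hm => by rwa [hp] at hm⟩
  · intro f
    exact heq fun h _ hm => by rwa [hp] at hm
  · refine heq fun h _ hm => ?_
    rw [hp] at hm ⊢
    obtain ⟨h₁, h₂⟩ := hne h
    refine bd_inv_mem_of_bd_mem h₁.symm ?_ hm
    rintro rfl
    exact h₂ (τ'.inv_inv _).symm
  · intro v w hvw
    refine or_iff_not_imp_left.2 fun hne' => hs'.pair_eq_of_separated he hne' ?_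
    intro h hh hvh hwh
    by_contra! hcon
    obtain ⟨k, rfl⟩ : h ∈ Set.range F := by rw [hrange]; exact hcon
    have hk : τ.inv k ≠ k := fun hk => hh (hF.map_eq_tail hk)
    rw [← hp v, hside hk, hvw, ← hside hk, hp] at hvh
    exact hs'.not_mem_inv hh hvh hwh

end LTree

end EMO

namespace EMO

/-- Let `E'` be a nonempty good family, `σ ∈ E'`, `E = E' \ {σ}`, and
let `τ'`, `τ` be painted stable `S`-trees corresponding to `E'` and `E`. Let `e₁` be
(a half of) the edge of `τ'` with `σ_e = σ`. Then there is a unique `S`-morphism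
`τ' → τ` contracting this edge and inducing on edge 2-partitions the tautological
inclusion `E ⊆ E'`. -/
theorem contraction_exists_unique {γ : Type} [Finite γ] (W : Set γ)
    (h3 : 3 ≤ Nat.card γ) (hW : 2 ≤ W.ncard)
    (E' : Set (Set (Set γ))) (hE' : GoodFamily W E') (σ : Set (Set γ)) (hσ : σ ∈ E')
    (τ' τ : LTree γ)
    (hτ' : τ'.PaintedStable W) (hfam' : τ'.edgeFamily = E')
    (hτ : τ.PaintedStable W) (hfam : τ.edgeFamily = E' \ {σ})
    (e₁ : τ'.Fl) (he : τ'.inv e₁ ≠ e₁) (heσ : τ'.flagPartition e₁ = σ) :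
    ∃! c : Contraction τ' τ e₁,
      ∀ f : τ.Fl, τ.inv f ≠ f → τ'.flagPartition (c.cF f) = τ.flagPartition f := by
  have hs' : τ'.Splits := LTree.splits_of_goodFamily hE' hfam'.subset
  have hs : τ.Splits := LTree.splits_of_goodFamily hE' (hfam.trans_subset Set.sdiff_subset)
  subst hfam' heσ
  obtain ⟨F, hF⟩ := LTree.exists_sidePreserving (hfam.trans_subset Set.sdiff_subset)
  obtain ⟨c, -⟩ := hF.exists_contraction hs hs' hτ.1 hτ'.1 he (hF.range_eq hs hs' hτ'.1 he hfam)
  exact ⟨c, fun f hf => hs.flagPartition_congr hs' hf (c.cF_edge hf)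
    ((c.sidePreserving hs hs').flagSide_map f hf), fun d _ => d.eq_of_stable hs hs' hτ'.1 c⟩

end EMO
end
end
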